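/- Suppose Condition 4.1 (with parameter θ₁) and Condition 4.3 (with parameters θ₂, θ₃) hold, and suppose additionally that each β_{nj} is asymptotically uniformly equicontinuous in probability, i.e. for every ε > 0, lim_{δ↓0} limsup_{n→∞} P( sup_{|s−t| ≤ δ} |β_{nj}(s) − β_{nj}(t)| > ε ) = 0 (this is the consequence of Condition 4.2 that the paper uses). Then for every j = 1,…,d, every ω ∈ (0, θ₁ ∧ θ₂) and every γ > 1/2: sup_{s ∈ [1−n^{−γ}, 1]} |β_{nj}(s)| = o_P(n^{−ω/2}) as n → ∞. -/

import Mathlib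

open MeasureTheory Filter Set
open scoped ENNReal NNReal

noncomputable section

namespace BBV

variable {Ω : Type*} [MeasurableSpace Ω] {E : Type*} [MeasurableSpace E] {d : ℕ}

/-- The real-valued indicator function of a set. -/
def indic {α : Type*} (s : Set α) (x : α) : ℝ := s.indicator (fun _ => (1 : ℝ)) x

/-- `Z n = o_P(r n)`: convergence to zero in (outer) probability at rate `r`. -/
def oP (P : Measure Ω) (Z : ℕ → Ω → ℝ) (r : ℕ → ℝ) : Prop :=
  ∀ ε : ℝ, 0 < ε → Tendsto (fun n => P {ω | ε * r n < |Z n ω|}) atTop (nhds 0)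

/-- `Z n = o_P(1)`: convergence to zero in (outer) probability. -/
def oP1 (P : Measure Ω) (Z : ℕ → Ω → ℝ) : Prop := oP P Z fun _ => 1

/-- `Z n = O_P(1)`: boundedness in (outer) probability. -/
def bigOP (P : Measure Ω) (Z : ℕ → Ω → ℝ) : Prop :=
  ∀ ε : ℝ, 0 < ε → ∃ M : ℝ, ∀ᶠ n in atTop, P {ω | M < |Z n ω|} ≤ ENNReal.ofReal ε

/-- Strict stationarity of a two-sided sequence: all finite-dimensional distributions
are invariant under shifts. -/
def StrictlyStationary (P : Measure Ω) (X : ℤ → Ω → E) : Prop :=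
  ∀ (m : ℕ) (idx : Fin m → ℤ) (k : ℤ),
    Measure.map (fun ω (p : Fin m) => X (idx p + k) ω) P =
      Measure.map (fun ω (p : Fin m) => X (idx p) ω) P

/-- The sigma-field generated by the variables `X i`, `i ∈ S`. -/
def mixSigma (X : ℤ → Ω → E) (S : Set ℤ) : MeasurableSpace Ω :=
  ⨆ i ∈ S, MeasurableSpace.comap (X i) inferInstance

/-- The alpha-mixing coefficient of the sequence `X`. -/
def alphaMix (P : Measure Ω) (X : ℤ → Ω → E) (k : ℕ) : ℝ :=
  sSup {r : ℝ | ∃ (i : ℤ) (A B : Set Ω),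
    MeasurableSet[mixSigma X (Set.Iic i)] A ∧
    MeasurableSet[mixSigma X (Set.Ici (i + (k : ℤ)))] B ∧
    r = |(P (A ∩ B)).toReal - (P A).toReal * (P B).toReal|}

/-- Exponentially decaying alpha-mixing coefficients: `α(k) = O(a^k)` for some `a ∈ (0,1)`. -/
def ExpAlphaMixing (P : Measure Ω) (X : ℤ → Ω → E) : Prop :=
  ∃ a ∈ Set.Ioo (0 : ℝ) 1, ∃ c : ℝ, ∀ k : ℕ, 1 ≤ k → alphaMix P X k ≤ c * a ^ k

/-- Marginal c.d.f. `F_j` of the stationary sequence. -/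
def margF (P : Measure Ω) (X : ℤ → Ω → Fin d → ℝ) (j : Fin d) (x : ℝ) : ℝ :=
  (P {ω | X 0 ω j ≤ x}).toReal

/-- `U_i = (F_1(X_{i1}),…,F_d(X_{id}))`. -/
def Uv (P : Measure Ω) (X : ℤ → Ω → Fin d → ℝ) (i : ℤ) (ω : Ω) (j : Fin d) : ℝ :=
  margF P X j (X i ω j)

/-- The copula `C` of the stationary distribution, i.e. the c.d.f. of `U_0`. -/
def cop (P : Measure Ω) (X : ℤ → Ω → Fin d → ℝ) (u : Fin d → ℝ) : ℝ :=
  (P {ω | ∀ j, Uv P X 0 ω j ≤ u j}).toReal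

/-- Empirical c.d.f. `G_n` of the (unobservable) sample `U_1,…,U_n`. -/
def Gn (P : Measure Ω) (X : ℤ → Ω → Fin d → ℝ) (n : ℕ) (u : Fin d → ℝ) (ω : Ω) : ℝ :=
  (n : ℝ)⁻¹ * ∑ i ∈ Finset.Icc (1 : ℤ) (n : ℤ), indic {ω' | ∀ j, Uv P X i ω' j ≤ u j} ω

/-- The empirical process `α_n = √n (G_n − C)`. -/
def alphan (P : Measure Ω) (X : ℤ → Ω → Fin d → ℝ) (n : ℕ) (u : Fin d → ℝ) (ω : Ω) : ℝ :=
  Real.sqrt n * (Gn P X n u ω - cop P X u)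

/-- Marginal empirical c.d.f. `G_{nj}` based on `U_{1j},…,U_{nj}`. -/
def Gnj (P : Measure Ω) (X : ℤ → Ω → Fin d → ℝ) (n : ℕ) (j : Fin d) (s : ℝ) (ω : Ω) : ℝ :=
  (n : ℝ)⁻¹ * ∑ i ∈ Finset.Icc (1 : ℤ) (n : ℤ), indic {ω' | Uv P X i ω' j ≤ s} ω

/-- The marginal empirical process `α_{nj}(s) = √n (G_{nj}(s) − s)`. -/
def alphanj (P : Measure Ω) (X : ℤ → Ω → Fin d → ℝ) (n : ℕ) (j : Fin d) (s : ℝ) (ω : Ω) : ℝ :=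
  Real.sqrt n * (Gnj P X n j s ω - s)

/-- Left-continuous generalized inverse: `H⁻(s) = inf{x : H(x) ≥ s}` for `s ≠ 0`,
and `H⁻(0) = sup{x : H(x) = 0}`. -/
def genInv (H : ℝ → ℝ) (s : ℝ) : ℝ :=
  if s = 0 then sSup {x | H x = 0} else sInf {x | s ≤ H x}

/-- The marginal quantile process `β_{nj}(s) = √n (G_{nj}⁻(s) − s)`. -/
def betanj (P : Measure Ω) (X : ℤ → Ω → Fin d → ℝ) (n : ℕ) (j : Fin d) (s : ℝ) (ω : Ω) : ℝ :=
  Real.sqrt n * (genInv (fun x => Gnj P X n j x ω) s - s)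

/-- Marginal empirical c.d.f. `F_{nj}` of the observations `X_{1j},…,X_{nj}`. -/
def empCdfX (X : ℤ → Ω → Fin d → ℝ) (n : ℕ) (j : Fin d) (x : ℝ) (ω : Ω) : ℝ :=
  (n : ℝ)⁻¹ * ∑ i ∈ Finset.Icc (1 : ℤ) (n : ℤ), indic {ω' | X i ω' j ≤ x} ω

/-- Pseudo-observations `Û_{ij} = n/(n+1) · F_{nj}(X_{ij})`. -/
def pseudoObs (X : ℤ → Ω → Fin d → ℝ) (n : ℕ) (i : ℤ) (ω : Ω) (j : Fin d) : ℝ :=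
  (n : ℝ) / ((n : ℝ) + 1) * empCdfX X n j (X i ω j) ω

/-- The empirical copula `Ĉ_n`. -/
def empCop (X : ℤ → Ω → Fin d → ℝ) (n : ℕ) (u : Fin d → ℝ) (ω : Ω) : ℝ :=
  (n : ℝ)⁻¹ * ∑ i ∈ Finset.Icc (1 : ℤ) (n : ℤ), indic {ω' | ∀ j, pseudoObs X n i ω' j ≤ u j} ω

/-- The empirical copula process `ĈP_n = √n (Ĉ_n − C)`. -/
def hatCP (P : Measure Ω) (X : ℤ → Ω → Fin d → ℝ) (n : ℕ) (u : Fin d → ℝ) (ω : Ω) : ℝ :=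
  Real.sqrt n * (empCop X n u ω - cop P X u)

/-- First-order partial derivative `Ċ_j` of `C`, defined everywhere as the limsup of
difference quotients (which coincides with the partial derivative wherever it exists). -/
def Cdot (C : (Fin d → ℝ) → ℝ) (j : Fin d) (u : Fin d → ℝ) : ℝ :=
  Filter.limsup (fun h : ℝ => (C (Function.update u j (u j + h)) - C u) / h)
    (nhdsWithin 0 {(0 : ℝ)}ᶜ)

/-- The process `C̄_n(u) = α_n(u) − Σ_j Ċ_j(u) α_n(u^{(j)})`. -/
def Cbar (P : Measure Ω) (X : ℤ → Ω → Fin d → ℝ) (n : ℕ) (u : Fin d → ℝ) (ω : Ω) : ℝ :=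
  alphan P X n u ω -
    ∑ j, Cdot (cop P X) j u * alphan P X n (Function.update (fun _ => (1 : ℝ)) j (u j)) ω

/-- `C_n(u) = G_n(G_{n1}⁻(u₁),…,G_{nd}⁻(u_d))`. -/
def copGI (P : Measure Ω) (X : ℤ → Ω → Fin d → ℝ) (n : ℕ) (u : Fin d → ℝ) (ω : Ω) : ℝ :=
  Gn P X n (fun j => genInv (fun x => Gnj P X n j x ω) (u j)) ω

/-- The empirical copula process `𝔺_n = √n (C_n − C)` based on generalized inverses. -/
def CPgi (P : Measure Ω) (X : ℤ → Ω → Fin d → ℝ) (n : ℕ) (u : Fin d → ℝ) (ω : Ω) : ℝ :=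
  Real.sqrt n * (copGI P X n u ω - cop P X u)

/-- `g₁(u) = min{ min_j u_j , min_j [1 − min_{k ≠ j} u_k] }`. -/
def g1 (u : Fin d → ℝ) : ℝ :=
  min (⨅ j, u j) (⨅ j : Fin d, (1 - ⨅ k : {k : Fin d // k ≠ j}, u (k : Fin d)))

/-- The weight function `g_ω(u) = g₁(u)^ω`. -/
def gW (w : ℝ) (u : Fin d → ℝ) : ℝ := g1 u ^ w

/-- `g̃_ω(u) = g_ω(u) + 1{g_ω(u) = 0}`. -/
def gTilde (w : ℝ) (u : Fin d → ℝ) : ℝ := if gW w u = 0 then 1 else gW w u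

/-- `N(a,b) = {u ∈ [0,1]^d : a < g₁(u) ≤ b}`. -/
def NN (d : ℕ) (a b : ℝ) : Set (Fin d → ℝ) :=
  {u | (∀ j, 0 ≤ u j ∧ u j ≤ 1) ∧ a < g1 u ∧ g1 u ≤ b}

/-- `V_j = {u ∈ [0,1]^d : u_j ∈ (0,1)}`. -/
def VV (d : ℕ) (j : Fin d) : Set (Fin d → ℝ) :=
  {u | (∀ k, 0 ≤ u k ∧ u k ≤ 1) ∧ 0 < u j ∧ u j < 1}

/-- Condition 2.1: existence, continuity and growth bounds for the first and second
order partial derivatives of the copula `C`. -/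
def Condition21 (C : (Fin d → ℝ) → ℝ) : Prop :=
  (∀ j : Fin d, ∀ u ∈ VV d j,
    HasDerivAt (fun t => C (Function.update u j t)) (Cdot C j u) (u j)) ∧
  (∀ j : Fin d, ContinuousOn (Cdot C j) (VV d j)) ∧
  ∃ Cdd : Fin d → Fin d → (Fin d → ℝ) → ℝ,
    (∀ j₁ j₂ : Fin d, ∀ u ∈ VV d j₁ ∩ VV d j₂,
      HasDerivAt (fun t => Cdot C j₂ (Function.update u j₁ t)) (Cdd j₁ j₂ u) (u j₁)) ∧
    (∀ j₁ j₂ : Fin d, ContinuousOn (Cdd j₁ j₂) (VV d j₁ ∩ VV d j₂)) ∧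
    ∃ K : ℝ, 0 < K ∧ ∀ j₁ j₂ : Fin d, ∀ u ∈ VV d j₁ ∩ VV d j₂,
      |Cdd j₁ j₂ u| ≤ K * min (1 / (u j₁ * (1 - u j₁))) (1 / (u j₂ * (1 - u j₂)))

/-- The weighted modulus of continuity `M_n(δ,μ)` of the empirical process. -/
def Mn (P : Measure Ω) (X : ℤ → Ω → Fin d → ℝ) (n : ℕ) (δ μ : ℝ) (ω : Ω) : ℝ :=
  ⨆ q ∈ {q : (Fin d → ℝ) × (Fin d → ℝ) |
      q.1 ∈ Set.Icc 0 1 ∧ q.2 ∈ Set.Icc 0 1 ∧ dist q.1 q.2 ≤ δ},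
    |alphan P X n q.1 ω - alphan P X n q.2 ω| / max (dist q.1 q.2 ^ μ) ((n : ℝ) ^ (-μ))

/-- Condition 4.1 with parameter `θ₁`. -/
def Condition41 (P : Measure Ω) (X : ℤ → Ω → Fin d → ℝ) (θ₁ : ℝ) : Prop :=
  ∀ μ ∈ Set.Ioo (0 : ℝ) θ₁, ∀ δ : ℕ → ℝ, Tendsto δ atTop (nhds 0) →
    oP1 P (fun n ω => Mn P X n (δ n) μ ω)

/-- Condition 4.3 with parameters `θ₂, θ₃`. -/
def Condition43 (P : Measure Ω) (X : ℤ → Ω → Fin d → ℝ) (θ₂ θ₃ : ℝ) : Prop :=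
  ∀ w ∈ Set.Ioo (0 : ℝ) θ₂, ∀ lam ∈ Set.Ioo (0 : ℝ) θ₃, ∀ j : Fin d,
    bigOP P (fun n ω => ⨆ s ∈ Set.Ioo (0 : ℝ) 1,
      |alphanj P X n j s ω| / (s * (1 - s)) ^ w) ∧
    bigOP P (fun n ω => ⨆ s ∈ Set.Ioo ((n : ℝ) ^ (-lam)) (1 - (n : ℝ) ^ (-lam)),
      |betanj P X n j s ω| / (s * (1 - s)) ^ w)

lemma le_biSup_real {α : Type*} {S : Set α} {f : α → ℝ} {B : ℝ} (hB : 0 ≤ B)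
    (hf : ∀ q ∈ S, f q ≤ B) {q : α} (hq : q ∈ S) : f q ≤ ⨆ p ∈ S, f p := by
  have hb : BddAbove (range fun p => ⨆ _ : p ∈ S, f p) := by
    refine ⟨B, ?_⟩
    rintro _ ⟨p, rfl⟩
    exact Real.iSup_le (fun hp => hf p hp) hB
  have h := le_ciSup hb q
  simpa [hq] using h

/-- A deterministic bound: the generalized inverse of `G` is close to the identity near one
when `G` itself is. -/
lemma abs_genInv_sub_le {G : ℝ → ℝ} (hG : Monotone G) (hG1 : G 1 = 1) {r s η : ℝ}
    (hr : 4 ≤ r) (hs : 1 - r⁻¹ ≤ s) (hs1 : s ≤ 1) (hη : η ≤ 1 / 2)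
    (hα : ∀ z, 1 - 3 * r⁻¹ ≤ z → z ≤ 1 → |r * (G z - z)| ≤ η) :
    |r * (genInv G s - s)| ≤ η + r⁻¹ := by
  have hr0 : 0 < r := by linarith
  have hi0 : 0 < r⁻¹ := inv_pos.mpr hr0
  have hi : r⁻¹ ≤ 1 / 4 := by
    rw [inv_le_comm₀ hr0 (by norm_num)]; linarith
  have hri : r * r⁻¹ = 1 := mul_inv_cancel₀ hr0.ne'
  have hsq : r⁻¹ * r⁻¹ ≤ r⁻¹ := by nlinarith
  have hrsq : r * (r⁻¹ * r⁻¹) = r⁻¹ := by rw [← mul_assoc, hri, one_mul]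
  have hs0 : s ≠ 0 := by intro h; linarith
  simp only [genInv, if_neg hs0]
  set A : Set ℝ := {x | s ≤ G x} with hA
  have hlow : ∀ z ∈ A, 1 - 2 * r⁻¹ ≤ z := by
    intro z hz
    by_contra! hlt
    have h1 : s ≤ G (1 - 2 * r⁻¹) := le_trans hz (hG hlt.le)
    have h2 := (le_abs_self _).trans (hα (1 - 2 * r⁻¹) (by linarith) (by linarith))
    have h3 : r * r⁻¹ ≤ r * (G (1 - 2 * r⁻¹) - (1 - 2 * r⁻¹)) :=
      mul_le_mul_of_nonneg_left (by linarith) hr0.le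
    linarith
  have h1A : (1 : ℝ) ∈ A := by rw [hA, mem_ofPred_eq, hG1]; exact hs1
  have hbdd : BddBelow A := ⟨_, hlow⟩
  have hx0 : 1 - 2 * r⁻¹ ≤ sInf A := le_csInf ⟨1, h1A⟩ hlow
  have hx1 : sInf A ≤ 1 := csInf_le hbdd h1A
  have hsq0 : 0 < r⁻¹ * r⁻¹ := mul_pos hi0 hi0
  obtain ⟨z, hzA, hzx⟩ := exists_lt_of_csInf_lt (⟨1, h1A⟩ : A.Nonempty)
    (lt_add_of_pos_right (sInf A) hsq0)
  have hmA : min z 1 ∈ A := by rcases min_choice z 1 with h | h <;> rw [h] <;> assumption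
  have hxm : sInf A ≤ min z 1 := csInf_le hbdd hmA
  have hmα := (le_abs_self _).trans (hα (min z 1) (by linarith) (min_le_right _ _))
  have hm : s ≤ G (min z 1) := hmA
  have hmz : min z 1 ≤ sInf A + r⁻¹ * r⁻¹ := (min_le_left _ _).trans hzx.le
  have hy : G (sInf A - r⁻¹ * r⁻¹) < s := by
    have := notMem_of_lt_csInf (sub_lt_self (sInf A) hsq0) hbdd
    simpa [hA] using this
  have hyα := (neg_abs_le _).trans' (neg_le_neg
    (hα (sInf A - r⁻¹ * r⁻¹) (by linarith) (by linarith)))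
  rw [abs_le]
  constructor
  · have : r * (s - sInf A) ≤ r * (G (min z 1) - min z 1 + r⁻¹ * r⁻¹) :=
      mul_le_mul_of_nonneg_left (by linarith) hr0.le
    rw [mul_add, hrsq] at this
    linarith
  · have : r * (sInf A - s) ≤
        r * (-(G (sInf A - r⁻¹ * r⁻¹) - (sInf A - r⁻¹ * r⁻¹)) + r⁻¹ * r⁻¹) :=
      mul_le_mul_of_nonneg_left (by linarith) hr0.le
    rw [mul_add, hrsq, mul_neg] at this
    linarith

section Marginals

variable {P : Measure Ω} {X : ℤ → Ω → Fin d → ℝ}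

lemma indic_mem_Icc {α : Type*} (s : Set α) (x : α) : indic s x ∈ Icc (0 : ℝ) 1 := by
  by_cases h : x ∈ s <;> simp [indic, h]

lemma Gn_mem_Icc (n : ℕ) (u : Fin d → ℝ) (ω : Ω) : Gn P X n u ω ∈ Icc (0 : ℝ) 1 := by
  refine ⟨mul_nonneg (by positivity) (Finset.sum_nonneg fun i _ => (indic_mem_Icc _ _).1), ?_⟩
  have h : ∑ i ∈ Finset.Icc (1 : ℤ) (n : ℤ), indic {ω' | ∀ j, Uv P X i ω' j ≤ u j} ω ≤ n := by
    refine (Finset.sum_le_card_nsmul _ _ 1 fun i _ => (indic_mem_Icc _ _).2).trans ?_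
    simp
  exact (mul_le_mul_of_nonneg_left h (by positivity)).trans inv_mul_le_one

lemma Gnj_mono (n : ℕ) (j : Fin d) (ω : Ω) : Monotone fun s => Gnj P X n j s ω := by
  intro s t hst
  refine mul_le_mul_of_nonneg_left (Finset.sum_le_sum fun i _ => ?_) (by positivity)
  exact indicator_le_indicator_of_subset (fun _ h => le_trans h hst) (fun _ => zero_le_one) ω

variable [IsProbabilityMeasure P]

lemma margF_le_one (j : Fin d) (x : ℝ) : margF P X j x ≤ 1 := measureReal_le_one

lemma margF_mono (j : Fin d) : Monotone (margF P X j) := fun _ _ h =>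
  measureReal_mono (fun _ hω => le_trans hω h)

lemma margF_eq_cdf (hmeas : ∀ i, Measurable (X i)) (j : Fin d) (x : ℝ) :
    margF P X j x = ProbabilityTheory.cdf (P.map fun ω => X 0 ω j) x := by
  have hm : Measurable fun ω => X 0 ω j := (measurable_pi_apply j).comp (hmeas 0)
  have := Measure.isProbabilityMeasure_map (μ := P) hm.aemeasurable
  rw [ProbabilityTheory.cdf_eq_real, map_measureReal_apply hm measurableSet_Iic]
  rfl

lemma exists_margF_eq (hmeas : ∀ i, Measurable (X i)) (j : Fin d)
    (hcont : Continuous (margF P X j)) {t : ℝ} (ht : t ∈ Ioo (0 : ℝ) 1) :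
    ∃ x, margF P X j x = t := by
  have hF : margF P X j = ProbabilityTheory.cdf (P.map fun ω => X 0 ω j) :=
    funext (margF_eq_cdf hmeas j)
  have hbot : Tendsto (margF P X j) atBot (nhds 0) := hF ▸ ProbabilityTheory.tendsto_cdf_atBot _
  have htop : Tendsto (margF P X j) atTop (nhds 1) := hF ▸ ProbabilityTheory.tendsto_cdf_atTop _
  exact mem_range_of_exists_le_of_exists_ge hcont
    (((hbot.eventually_lt_const ht.1).exists).imp fun _ h => h.le)
    (((htop.eventually_const_lt ht.2).exists).imp fun _ h => h.le)

/-- Probability integral transform. -/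
lemma measureReal_Uv_le (hmeas : ∀ i, Measurable (X i)) (j : Fin d)
    (hcont : Continuous (margF P X j)) {t : ℝ} (ht : t ∈ Ioc (0 : ℝ) 1) :
    P.real {ω | Uv P X 0 ω j ≤ t} = t := by
  rcases ht.2.eq_or_lt with rfl | ht1
  · have : {ω | Uv P X 0 ω j ≤ 1} = univ := eq_univ_of_forall fun ω => margF_le_one j _
    rw [this, probReal_univ]
  apply le_antisymm
  · refine le_of_forall_gt_imp_ge_of_dense fun t' htt' => ?_
    rcases le_or_gt 1 t' with h1 | h1
    · exact measureReal_le_one.trans h1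
    obtain ⟨x, hx⟩ := exists_margF_eq hmeas j hcont ⟨ht.1.trans htt', h1⟩
    rw [← hx]
    refine measureReal_mono fun ω (hω : margF P X j (X 0 ω j) ≤ t) => ?_
    exact ((margF_mono j).reflect_lt (hω.trans_lt (hx ▸ htt'))).le
  · obtain ⟨x, hx⟩ := exists_margF_eq hmeas j hcont ⟨ht.1, ht1⟩
    conv_lhs => rw [← hx]
    exact measureReal_mono fun ω (hω : X 0 ω j ≤ x) => (margF_mono j hω).trans hx.le

lemma forall_le_update_iff (i : ℤ) (ω : Ω) (j : Fin d) (t : ℝ) :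
    (∀ k, Uv P X i ω k ≤ Function.update (fun _ => (1 : ℝ)) j t k) ↔ Uv P X i ω j ≤ t := by
  refine ⟨fun h => by simpa using h j, fun h k => ?_⟩
  rcases eq_or_ne k j with rfl | hk
  · simpa using h
  · rw [Function.update_of_ne hk]
    exact margF_le_one k (X i ω k)

lemma alphan_update (hmeas : ∀ i, Measurable (X i)) (j : Fin d)
    (hcont : Continuous (margF P X j)) (n : ℕ) {t : ℝ} (ht : t ∈ Ioc (0 : ℝ) 1) (ω : Ω) :
    alphan P X n (Function.update (fun _ => 1) j t) ω = alphanj P X n j t ω := by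
  have h := measureReal_Uv_le hmeas j hcont ht
  rw [measureReal_def] at h
  simp only [alphan, alphanj, Gn, Gnj, cop, forall_le_update_iff, h]

lemma Gnj_one {n : ℕ} (hn : n ≠ 0) (j : Fin d) (ω : Ω) : Gnj P X n j 1 ω = 1 := by
  have h : ∀ i, indic {ω' | Uv P X i ω' j ≤ 1} ω = 1 := fun i =>
    indicator_of_mem (s := {ω' | Uv P X i ω' j ≤ 1}) (margF_le_one j (X i ω j)) _
  have hn' : (n : ℝ) ≠ 0 := Nat.cast_ne_zero.mpr hn
  simp [Gnj, h, hn']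

lemma abs_alphan_sub_le (n : ℕ) (u v : Fin d → ℝ) (ω : Ω) :
    |alphan P X n u ω - alphan P X n v ω| ≤ Real.sqrt n * 2 := by
  have hC : ∀ u, cop P X u ∈ Icc (0 : ℝ) 1 := fun u => ⟨ENNReal.toReal_nonneg, measureReal_le_one⟩
  have hu := Gn_mem_Icc (P := P) (X := X) n u ω
  have hv := Gn_mem_Icc (P := P) (X := X) n v ω
  rw [alphan, alphan, ← mul_sub, abs_mul, abs_of_nonneg (Real.sqrt_nonneg _)]
  refine mul_le_mul_of_nonneg_left (abs_le.mpr ⟨?_, ?_⟩) (Real.sqrt_nonneg _) <;>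
    linarith [(hC u).1, (hC u).2, (hC v).1, (hC v).2, hu.1, hu.2, hv.1, hv.2]

lemma abs_alphan_sub_le_Mn {n : ℕ} (hn : n ≠ 0) {δ μ : ℝ} {u v : Fin d → ℝ}
    (hu : u ∈ Icc 0 1) (hv : v ∈ Icc 0 1) (huv : dist u v ≤ δ) (ω : Ω) :
    |alphan P X n u ω - alphan P X n v ω| ≤
      Mn P X n δ μ ω * max (dist u v ^ μ) ((n : ℝ) ^ (-μ)) := by
  have hpos : 0 < (n : ℝ) ^ (-μ) :=
    Real.rpow_pos_of_pos (Nat.cast_pos.mpr (Nat.pos_of_ne_zero hn)) _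
  rw [← div_le_iff₀ (lt_max_of_lt_right hpos)]
  refine le_biSup_real (S := {q : (Fin d → ℝ) × (Fin d → ℝ) |
      q.1 ∈ Set.Icc 0 1 ∧ q.2 ∈ Set.Icc 0 1 ∧ dist q.1 q.2 ≤ δ})
    (f := fun q => |alphan P X n q.1 ω - alphan P X n q.2 ω| /
      max (dist q.1 q.2 ^ μ) ((n : ℝ) ^ (-μ)))
    (B := Real.sqrt n * 2 / (n : ℝ) ^ (-μ)) (by positivity) (fun q _ => ?_) (q := (u, v))
    ⟨hu, hv, huv⟩
  exact div_le_div₀ (by positivity) (abs_alphan_sub_le n _ _ ω) hpos (le_max_right _ _)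

lemma abs_alphanj_le_Mn (hmeas : ∀ i, Measurable (X i)) (j : Fin d)
    (hcont : Continuous (margF P X j)) {n : ℕ} (hn : n ≠ 0) {δ μ z : ℝ} (hμ : 0 ≤ μ)
    (hz0 : 0 < z) (hz : 1 - δ ≤ z) (hz1 : z ≤ 1) (ω : Ω) :
    |alphanj P X n j z ω| ≤ |Mn P X n δ μ ω| * max (δ ^ μ) ((n : ℝ) ^ (-μ)) := by
  have hmem : ∀ t ∈ Ioc (0 : ℝ) 1, Function.update (fun _ : Fin d => (1 : ℝ)) j t ∈ Icc 0 1 := by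
    refine fun t ht => ⟨fun k => ?_, fun k => ?_⟩ <;>
    · rcases eq_or_ne k j with rfl | hk
      · simp [ht.1.le, ht.2]
      · simp [hk]
  have hdist : dist (Function.update (fun _ : Fin d => (1 : ℝ)) j z)
      (Function.update (fun _ => 1) j 1) ≤ δ := by
    refine (dist_pi_le_iff (by linarith)).mpr fun k => ?_
    rcases eq_or_ne k j with rfl | hk
    · simp only [Function.update_self, Real.dist_eq]
      rw [abs_le]; constructor <;> linarith
    · simp only [Function.update_of_ne hk, dist_self]; linarith
  have hone : (1 : ℝ) ∈ Ioc (0 : ℝ) 1 := by simp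
  have h := abs_alphan_sub_le_Mn (P := P) (X := X) (μ := μ) hn (hmem z ⟨hz0, hz1⟩)
    (hmem 1 hone) hdist ω
  rw [alphan_update hmeas j hcont n ⟨hz0, hz1⟩, alphan_update hmeas j hcont n hone] at h
  have h1 : alphanj P X n j 1 ω = 0 := by simp [alphanj, Gnj_one hn]
  rw [h1, sub_zero] at h
  refine h.trans ((mul_le_mul_of_nonneg_right (le_abs_self _) (by positivity)).trans ?_)
  gcongr

end Marginals

/-- Lemma 6.3: under Conditions 4.1, 4.3 and asymptotic uniform equicontinuity of
`β_{nj}`, one has `sup_{s ∈ [1−n^{−γ},1]} |β_{nj}(s)| = o_P(n^{−ω/2})`. -/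
theorem betanj_negligible_near_one
    {Ω : Type*} [MeasurableSpace Ω] {d : ℕ} (hd : 2 ≤ d)
    (P : Measure Ω) [IsProbabilityMeasure P] (X : ℤ → Ω → Fin d → ℝ)
    (hmeas : ∀ i, Measurable (X i)) (hstat : StrictlyStationary P X)
    (hcont : ∀ j, Continuous (margF P X j))
    (θ₁ θ₂ θ₃ : ℝ) (hθ₁ : θ₁ ∈ Set.Ioc (0 : ℝ) (1/2)) (hθ₂ : θ₂ ∈ Set.Ioc (0 : ℝ) (1/2))
    (hθ₃ : θ₃ ∈ Set.Ioc (1/2 : ℝ) 1)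
    (h41 : Condition41 P X θ₁) (h43 : Condition43 P X θ₂ θ₃)
    (hequi : ∀ j : Fin d, ∀ ε : ℝ, 0 < ε →
      Tendsto (fun δ : ℝ =>
          Filter.limsup (fun n => P {ω | ε <
            ⨆ q ∈ {q : ℝ × ℝ | q.1 ∈ Set.Icc (0 : ℝ) 1 ∧ q.2 ∈ Set.Icc (0 : ℝ) 1 ∧
                |q.1 - q.2| ≤ δ},
              |betanj P X n j q.1 ω - betanj P X n j q.2 ω|}) atTop)
        (nhdsWithin 0 (Set.Ioi (0 : ℝ))) (nhds 0)) :
    ∀ j : Fin d, ∀ w ∈ Set.Ioo (0 : ℝ) (min θ₁ θ₂), ∀ γ : ℝ, 1/2 < γ →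
      oP P (fun n ω => ⨆ s ∈ Set.Icc (1 - (n : ℝ) ^ (-γ)) 1, |betanj P X n j s ω|)
        (fun n => (n : ℝ) ^ (-(w / 2))) := by
  intro j w hw γ hγ ε hε
  have hw0 : 0 < w := hw.1
  have hwθ : w < θ₁ := hw.2.trans_le (min_le_left _ _)
  have hwhalf : w < 1 / 2 := hwθ.trans_le hθ₁.2
  set ε' : ℝ := min (ε / 6) (1 / 6)
  have hε'0 : 0 < ε' := lt_min (by positivity) (by norm_num)
  have hε'1 : ε' ≤ ε / 6 := min_le_left _ _
  have hε'2 : ε' ≤ 1 / 6 := min_le_right _ _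
  have hδ : Tendsto (fun n : ℕ => 3 * (Real.sqrt n)⁻¹) atTop (nhds 0) := by
    simpa using ((Real.tendsto_sqrt_atTop.comp
      tendsto_natCast_atTop_atTop).inv_tendsto_atTop).const_mul 3
  have hM := h41 w ⟨hw0, hwθ⟩ _ hδ ε' hε'0
  have hsmall : ∀ᶠ n : ℕ in atTop, (n : ℝ) ^ (-(1 / 2 - w / 2)) < ε / 2 :=
    ((tendsto_rpow_neg_atTop (by linarith)).comp
      tendsto_natCast_atTop_atTop).eventually_lt_const (by positivity)
  refine tendsto_of_tendsto_of_tendsto_of_le_of_le' tendsto_const_nhds hM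
    (Eventually.of_forall fun _ => zero_le) ?_
  filter_upwards [eventually_ge_atTop 16, hsmall] with n hn hns
  refine measure_mono fun ω hω => ?_
  by_contra hω'
  have hMω : |Mn P X n (3 * (Real.sqrt n)⁻¹) w ω| ≤ ε' := by
    simpa only [mul_one, mem_ofPred_eq, not_lt] using hω'
  rw [mem_ofPred_eq] at hω
  refine hω.not_ge ?_
  have hn1 : (1 : ℝ) ≤ n := by exact_mod_cast (by omega : 1 ≤ n)
  have hn0 : (0 : ℝ) < n := by linarith
  have hr : 4 ≤ Real.sqrt n := by
    apply Real.le_sqrt_of_sq_le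
    norm_num
    exact_mod_cast hn
  have hinv : (Real.sqrt n)⁻¹ = (n : ℝ) ^ (-(1 / 2 : ℝ)) := by
    rw [Real.sqrt_eq_rpow, Real.rpow_neg hn0.le]
  have hmax : max ((3 * (Real.sqrt n)⁻¹) ^ w) ((n : ℝ) ^ (-w)) ≤ 3 * (n : ℝ) ^ (-(w / 2)) := by
    apply max_le
    · rw [Real.mul_rpow (by norm_num) (by positivity), hinv, ← Real.rpow_mul hn0.le]
      have h3 : (3 : ℝ) ^ w ≤ 3 := by
        simpa using Real.rpow_le_rpow_of_exponent_le (x := 3) (by norm_num)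
          (by linarith : w ≤ 1)
      rw [show -(1 / 2) * w = -(w / 2) by ring]
      gcongr
    · have h1 : (n : ℝ) ^ (-w) ≤ (n : ℝ) ^ (-(w / 2)) :=
        Real.rpow_le_rpow_of_exponent_le hn1 (by linarith)
      have h2 : 0 ≤ (n : ℝ) ^ (-(w / 2)) := by positivity
      linarith
  have hle1 : (n : ℝ) ^ (-(w / 2)) ≤ 1 := Real.rpow_le_one_of_one_le_of_nonpos hn1 (by linarith)
  have hpow0 : 0 ≤ (n : ℝ) ^ (-(w / 2)) := by positivity
  have hinv4 : (Real.sqrt n)⁻¹ ≤ 1 / 4 := by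
    rw [inv_le_comm₀ (by linarith) (by norm_num)]; linarith
  have hrate : (Real.sqrt n)⁻¹ ≤ ε / 2 * (n : ℝ) ^ (-(w / 2)) := by
    rw [hinv, show -(1 / 2 : ℝ) = -(1 / 2 - w / 2) + -(w / 2) by ring, Real.rpow_add hn0]
    gcongr
  have hα : ∀ z, 1 - 3 * (Real.sqrt n)⁻¹ ≤ z → z ≤ 1 →
      |Real.sqrt n * (Gnj P X n j z ω - z)| ≤ 3 * ε' * (n : ℝ) ^ (-(w / 2)) := by
    intro z hz hz1
    refine (abs_alphanj_le_Mn hmeas j (hcont j) (by omega) hw0.le (by linarith) hz hz1 ω).trans ?_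
    calc _ ≤ ε' * (3 * (n : ℝ) ^ (-(w / 2))) := by gcongr
      _ = _ := by ring
  have hbound : ∀ s ∈ Icc (1 - (n : ℝ) ^ (-γ)) 1,
      |betanj P X n j s ω| ≤ ε * (n : ℝ) ^ (-(w / 2)) := by
    intro s hs
    have hs0 : 1 - (Real.sqrt n)⁻¹ ≤ s := by
      have : (n : ℝ) ^ (-γ) ≤ (Real.sqrt n)⁻¹ :=
        hinv ▸ Real.rpow_le_rpow_of_exponent_le hn1 (by linarith)
      linarith [hs.1]
    refine (abs_genInv_sub_le (Gnj_mono n j ω) (Gnj_one (by omega) j ω) hr hs0 hs.2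
      (by nlinarith) hα).trans ?_
    nlinarith
  have hnn : 0 ≤ ε * (n : ℝ) ^ (-(w / 2)) := by positivity
  rw [abs_of_nonneg (Real.iSup_nonneg fun s => Real.iSup_nonneg fun _ => abs_nonneg _)]
  exact Real.iSup_le (fun s => Real.iSup_le (fun hs => hbound s hs) hnn) hnn

end BBV
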